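/- arXiv:2203.03425 — 2 statements merged into one kernel-verified Lean document; each statement's English description precedes it below -/
import Mathlib

section
/- Let K be a finite lattice semiring with a probability distribution p: K⁺ → (0,1], and τ a finite relational vocabulary. Then for every sentence ψ ∈ FO(τ) and every value j ∈ K, the sequence (μ_{n,p}[π⟦ψ⟧ = j])_{n<ω} converges exponentially fast to either 0 or 1 as n → ∞. Moreover, the only possible almost sure valuations of sentences are 0, 1 and ε_K, and each of them is attained: as_{K,p}(FO(τ)) = {0, 1, ε_K}. -/
open MeasureTheory Filter Set
open scoped ENNReal BigOperators

/-- A (fully instantiated) literal over the relational vocabulary given by the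
relation symbols `R` with arities `ar`, on the universe `A`: a relation symbol,
a tuple of arguments, and a polarity (`true` = positive atom, `false` = negated atom). -/
structure Lit (R : Type) (ar : R → ℕ) (A : Type) : Type where
  rel : R
  args : Fin (ar rel) → A
  pos : Bool

/-- A (fully instantiated) relational atom. -/
abbrev Atoms (R : Type) (ar : R → ℕ) (A : Type) : Type := (r : R) × (Fin (ar r) → A)

variable {R : Type} {ar : R → ℕ} {A B K : Type}

/-- Renaming of a literal along a map of universes. -/
def Lit.map (f : A → B) (l : Lit R ar A) : Lit R ar B :=
  ⟨l.rel, fun j => f (l.args j), l.pos⟩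

/-- A `K`-interpretation (or atomic type) is model-defining / consistent (w.r.t. the
zero element `z` of `K`) if out of each pair of complementary literals exactly one is
mapped to `z`. -/
def ModelDefining (z : K) (π : Lit R ar A → K) : Prop :=
  ∀ (r : R) (as : Fin (ar r) → A), (π ⟨r, as, true⟩ = z ↔ π ⟨r, as, false⟩ ≠ z)

/-- The atomic `m`-type realised by the tuple `a` in the interpretation `π`. -/
def typeOf {m : ℕ} (π : Lit R ar A → K) (a : Fin m → A) : Lit R ar (Fin m) → K :=
  fun l => π (l.map a)

/-- The tuple `a` (of pairwise distinct elements) realises the atomic `m`-type `ρ` in `π`. -/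
def Realizes {m : ℕ} (π : Lit R ar A → K) (a : Fin m → A) (ρ : Lit R ar (Fin m) → K) : Prop :=
  Function.Injective a ∧ typeOf π a = ρ

/-- The atomic `(m+1)`-type `ρp` extends the atomic `m`-type `ρ`. -/
def Extends {m : ℕ} (ρp : Lit R ar (Fin (m+1)) → K) (ρ : Lit R ar (Fin m) → K) : Prop :=
  ∀ l : Lit R ar (Fin m), ρp (l.map Fin.castSucc) = ρ l

/-- The `k`-extension property of an interpretation `π` (with zero element `z`). -/
def ExtProp (z : K) (π : Lit R ar A → K) (k : ℕ) : Prop :=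
  ∀ m, m < k → ∀ ρ : Lit R ar (Fin m) → K, ModelDefining z ρ →
    ∀ ρp : Lit R ar (Fin (m+1)) → K, ModelDefining z ρp → Extends ρp ρ →
      ∀ a : Fin m → A, Realizes π a ρ →
        ∃ b : A, b ∉ Set.range a ∧ Realizes π (Fin.snoc a b) ρp

/-- A sequence of extended nonnegative reals converges to `L` exponentially fast. -/
def ExpConv (f : ℕ → ℝ≥0∞) (L : ℝ≥0∞) : Prop :=
  ∃ C q : ℝ≥0∞, C ≠ ⊤ ∧ q < 1 ∧ ∀ n, f n ≤ L + C * q ^ n ∧ L ≤ f n + C * q ^ n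

/-- The interpretation determined by a sample point: each atom gets a pair
(value of positive literal, value of negated literal). -/
def interpOf (ω : Atoms R ar A → K × K) : Lit R ar A → K :=
  fun l => if l.pos then (ω ⟨l.rel, l.args⟩).1 else (ω ⟨l.rel, l.args⟩).2

/-- The per-atom distribution: with probability 1/2 the atom is true (its negation
gets value `z`, i.e. false, and its value is sampled from `p`), with probability 1/2
it is false (symmetrically). -/
noncomputable def atomMeasure [MeasurableSpace K] (z : K) (p : Measure K) : Measure (K × K) :=
  (2⁻¹ : ℝ≥0∞) • (Measure.map (fun j => (j, z)) p + Measure.map (fun j => (z, j)) p)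

/-- The distribution `μ_{n,p}` of random `K`-interpretations on universe `[n]`,
presented on the sample space assigning to each atom the pair of values of its
positive and negated literal. -/
noncomputable def muI [MeasurableSpace K] [Fintype R] (z : K) (p : Measure K) (n : ℕ) :
    Measure (Atoms R ar (Fin n) → K × K) :=
  Measure.pi fun _ => atomMeasure z p
/-- First-order formulae in negation normal form over the vocabulary `(R, ar)`,
with standard quantifiers, in a context of `i` variables (de Bruijn style:
`ex`/`all` bind the last variable of the extended context). -/
inductive FO (R : Type) (ar : R → ℕ) : ℕ → Type
  | eq   : {i : ℕ} → Fin i → Fin i → FO R ar i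
  | ne   : {i : ℕ} → Fin i → Fin i → FO R ar i
  | atom : {i : ℕ} → (r : R) → (Fin (ar r) → Fin i) → Bool → FO R ar i
  | or   : {i : ℕ} → FO R ar i → FO R ar i → FO R ar i
  | and  : {i : ℕ} → FO R ar i → FO R ar i → FO R ar i
  | ex   : {i : ℕ} → FO R ar (i+1) → FO R ar i
  | all  : {i : ℕ} → FO R ar (i+1) → FO R ar i

/-- Semiring semantics of first-order formulae over a commutative semiring `K`:
`∨`/`∃` are sums, `∧`/`∀` are products. -/
noncomputable def evalS [CommSemiring K] [Fintype A] [DecidableEq A]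
    (π : Lit R ar A → K) : {i : ℕ} → FO R ar i → (Fin i → A) → K
  | _, .eq j l, v => if v j = v l then 1 else 0
  | _, .ne j l, v => if v j = v l then 0 else 1
  | _, .atom r as pos, v => π ⟨r, fun j => v (as j), pos⟩
  | _, .or φ θ, v => evalS π φ v + evalS π θ v
  | _, .and φ θ, v => evalS π φ v * evalS π θ v
  | _, .ex φ, v => ∑ b : A, evalS π φ (Fin.snoc v b)
  | _, .all φ, v => ∏ b : A, evalS π φ (Fin.snoc v b)

/-- Semantics of first-order formulae in a lattice semiring (a bounded distributive
lattice, with `0 = ⊥`, `1 = ⊤`, addition `⊔` and multiplication `⊓`). -/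
noncomputable def evalL [DistribLattice K] [BoundedOrder K] [Fintype A] [DecidableEq A]
    (π : Lit R ar A → K) : {i : ℕ} → FO R ar i → (Fin i → A) → K
  | _, .eq j l, v => if v j = v l then ⊤ else ⊥
  | _, .ne j l, v => if v j = v l then ⊥ else ⊤
  | _, .atom r as pos, v => π ⟨r, fun j => v (as j), pos⟩
  | _, .or φ θ, v => evalL π φ v ⊔ evalL π θ v
  | _, .and φ θ, v => evalL π φ v ⊓ evalL π θ v
  | _, .ex φ, v => Finset.univ.sup fun b : A => evalL π φ (Fin.snoc v b)
  | _, .all φ, v => Finset.univ.inf fun b : A => evalL π φ (Fin.snoc v b)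
/-- The smallest positive element `ε_K = ⨅ {j ∈ K : j ≠ 0}` of a finite lattice semiring. -/
noncomputable def epsK (K : Type) [DistribLattice K] [BoundedOrder K] [Fintype K]
    [DecidableEq K] : K :=
  (Finset.univ.filter fun j : K => j ≠ ⊥).inf id

/-- A literal over the variables `x_1, …, x_{m+1}` containing the new variable `x_{m+1}`. -/
def NewLit {m : ℕ} (l : Lit R ar (Fin (m+1))) : Prop := ∃ j, l.args j = Fin.last m

/-- `ρp` is a maximal extension of `ρ`: all new literals get values in `{0,1} = {⊥,⊤}`. -/
def MaxExt [Lattice K] [BoundedOrder K] {m : ℕ}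
    (ρp : Lit R ar (Fin (m+1)) → K) (ρ : Lit R ar (Fin m) → K) : Prop :=
  Extends ρp ρ ∧ ∀ l : Lit R ar (Fin (m+1)), NewLit l → (ρp l = ⊥ ∨ ρp l = ⊤)

/-- `ρm` is a `δ`-small extension of `ρ`: all new literals get values `≤ δ`. -/
def SmallExt [Lattice K] [BoundedOrder K] {m : ℕ} (δ : K)
    (ρm : Lit R ar (Fin (m+1)) → K) (ρ : Lit R ar (Fin m) → K) : Prop :=
  Extends ρm ρ ∧ ∀ l : Lit R ar (Fin (m+1)), NewLit l → ρm l ≤ δ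

/-- The `(k,δ)`-extension property: every maximal extension of the type of a tuple is
realised, and also some `δ`-small extension below it is realised. -/
def ExtPropKD [Lattice K] [BoundedOrder K] (π : Lit R ar A → K) (k : ℕ) (δ : K) : Prop :=
  ∀ m, m < k → ∀ a : Fin m → A, Function.Injective a →
    ∀ ρp : Lit R ar (Fin (m+1)) → K, ModelDefining ⊥ ρp → MaxExt ρp (typeOf π a) →
      (∃ b : A, b ∉ Set.range a ∧ typeOf π (Fin.snoc a b) = ρp) ∧
      (∃ c : A, c ∉ Set.range a ∧ ModelDefining ⊥ (typeOf π (Fin.snoc a c)) ∧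
        typeOf π (Fin.snoc a c) ≤ ρp ∧ SmallExt δ (typeOf π (Fin.snoc a c)) (typeOf π a))

/-- `p` is weakly `ε`-bounded. -/
def WeaklyBounded [Lattice K] [BoundedOrder K] [MeasurableSpace K]
    (p : Measure K) (ε : K) : Prop :=
  0 < p {ε} ∧ ∀ δ : K, δ ≠ ⊥ → ¬ ε ≤ δ → p {x : K | ⊥ < x ∧ x ≤ δ} = 0

/-- `p` is strictly `ε`-bounded. -/
def StrictlyBounded [Lattice K] [BoundedOrder K] [MeasurableSpace K]
    (p : Measure K) (ε : K) : Prop :=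
  (∀ ε' : K, ¬ WeaklyBounded p ε') ∧ p {x : K | ⊥ < x ∧ x ≤ ε} = 0 ∧
    ∀ δ : K, ε < δ → 0 < p {x : K | ⊥ < x ∧ x ≤ δ}

/-- `p` is `ε`-bounded on small semiring values. -/
def EpsBounded [Lattice K] [BoundedOrder K] [MeasurableSpace K]
    (p : Measure K) (ε : K) : Prop :=
  WeaklyBounded p ε ∨ StrictlyBounded p ε

/-- `δ ∈ K⁺` is `p`-relevant (w.r.t. the parameter `ε` of the `ε`-bounded measure `p`). -/
def PRelevant [Lattice K] [BoundedOrder K] [MeasurableSpace K]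
    (p : Measure K) (ε δ : K) : Prop :=
  δ ≠ ⊥ ∧ (ε < δ ∨ (0 < p {ε} ∧ δ = ε))

/-- An interval of `K`: a closed, open, or half-open order interval. -/
def IsInterval [Lattice K] (J : Set K) : Prop :=
  ∃ a b : K, J = Set.Icc a b ∨ J = Set.Ico a b ∨ J = Set.Ioc a b ∨ J = Set.Ioo a b

/-- Extension of an atomic type `ρ` by a new element: atoms mentioning it are made true or
false according to `s`, and all the new true literals get the value `t`. -/
def extType [Bot K] {m : ℕ} (ρ : Lit R ar (Fin m) → K) (s : Atoms R ar (Fin (m + 1)) → Bool)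
    (t : K) : Lit R ar (Fin (m + 1)) → K := fun l =>
  if h : ∀ j, l.args j ≠ Fin.last m then
    ρ ⟨l.rel, fun j => (l.args j).castPred (h j), l.pos⟩
  else if s ⟨l.rel, l.args⟩ = l.pos then t else ⊥

/-- Value of a formula determined by the atomic type `ρ` of a tuple of distinct elements, where
`e` says which element each free variable denotes. A new existential witness gets the value `⊤`
on its true literals, a new universal one gets `ε`. -/
noncomputable def typeEval [DistribLattice K] [BoundedOrder K] [Fintype R] [DecidableEq R]
    (ε : K) : {i : ℕ} → FO R ar i → (m : ℕ) → (Fin i → Fin m) → (Lit R ar (Fin m) → K) → K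
  | _, .eq j l, _, e, _ => if e j = e l then ⊤ else ⊥
  | _, .ne j l, _, e, _ => if e j = e l then ⊥ else ⊤
  | _, .atom r as pos, _, e, ρ => ρ ⟨r, fun j => e (as j), pos⟩
  | _, .or φ θ, m, e, ρ => typeEval ε φ m e ρ ⊔ typeEval ε θ m e ρ
  | _, .and φ θ, m, e, ρ => typeEval ε φ m e ρ ⊓ typeEval ε θ m e ρ
  | _, .ex φ, m, e, ρ =>
      (Finset.univ.sup fun j : Fin m => typeEval ε φ m (Fin.snoc e j) ρ) ⊔
      Finset.univ.sup fun s : Atoms R ar (Fin (m + 1)) → Bool =>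
        typeEval ε φ (m + 1) (Fin.snoc (fun j => (e j).castSucc) (Fin.last m)) (extType ρ s ⊤)
  | _, .all φ, m, e, ρ =>
      (Finset.univ.inf fun j : Fin m => typeEval ε φ m (Fin.snoc e j) ρ) ⊓
      Finset.univ.inf fun s : Atoms R ar (Fin (m + 1)) → Bool =>
        typeEval ε φ (m + 1) (Fin.snoc (fun j => (e j).castSucc) (Fin.last m)) (extType ρ s ε)

section TypeEval

variable [DistribLattice K] [BoundedOrder K]

theorem extType_inf_le {m : ℕ} {ρ ρ' : Lit R ar (Fin m) → K} {c t t' : K}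
    (h : ∀ l, ρ l ⊓ c ≤ ρ' l) (ht : t ⊓ c ≤ t') (s : Atoms R ar (Fin (m + 1)) → Bool)
    (l : Lit R ar (Fin (m + 1))) : extType ρ s t l ⊓ c ≤ extType ρ' s t' l := by
  unfold extType
  split_ifs
  · exact h _
  · exact ht
  · simp

theorem extType_le_sup {m : ℕ} {ρ ρ' : Lit R ar (Fin m) → K} {c t t' : K}
    (h : ∀ l, ρ l ≤ ρ' l ⊔ c) (ht : t ≤ t' ⊔ c) (s : Atoms R ar (Fin (m + 1)) → Bool)
    (l : Lit R ar (Fin (m + 1))) : extType ρ s t l ≤ extType ρ' s t' l ⊔ c := by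
  unfold extType
  split_ifs
  · exact h _
  · exact ht
  · simp

variable [Fintype R] [DecidableEq R]

theorem typeEval_inf_le (ε c : K) {i : ℕ} (φ : FO R ar i) :
    ∀ (m : ℕ) (e : Fin i → Fin m) (ρ ρ' : Lit R ar (Fin m) → K), (∀ l, ρ l ⊓ c ≤ ρ' l) →
      typeEval ε φ m e ρ ⊓ c ≤ typeEval ε φ m e ρ' := by
  induction φ with
  | eq | ne => intro m e ρ ρ' h; exact inf_le_left
  | atom r as pos => intro m e ρ ρ' h; exact h _
  | or φ θ ih₁ ih₂ =>
    intro m e ρ ρ' h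
    simp only [typeEval, inf_sup_right]
    exact sup_le_sup (ih₁ m e ρ ρ' h) (ih₂ m e ρ ρ' h)
  | and φ θ ih₁ ih₂ =>
    intro m e ρ ρ' h
    simp only [typeEval]
    exact le_inf ((inf_le_inf_right c inf_le_left).trans (ih₁ m e ρ ρ' h))
      ((inf_le_inf_right c inf_le_right).trans (ih₂ m e ρ ρ' h))
  | ex φ ih =>
    intro m e ρ ρ' h
    simp only [typeEval, inf_sup_right, Finset.sup_inf_distrib_right]
    exact sup_le_sup (Finset.sup_mono_fun fun j _ => ih m _ ρ ρ' h)
      (Finset.sup_mono_fun fun s _ => ih (m + 1) _ _ _ (extType_inf_le h inf_le_left s))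
  | all φ ih =>
    intro m e ρ ρ' h
    simp only [typeEval]
    refine le_inf (Finset.le_inf fun j hj => ?_) (Finset.le_inf fun s hs => ?_)
    · exact (inf_le_inf_right c (inf_le_left.trans (Finset.inf_le hj))).trans (ih m _ ρ ρ' h)
    · exact (inf_le_inf_right c (inf_le_right.trans (Finset.inf_le hs))).trans
        (ih (m + 1) _ _ _ (extType_inf_le h inf_le_left s))

theorem typeEval_le_sup (ε c : K) {i : ℕ} (φ : FO R ar i) :
    ∀ (m : ℕ) (e : Fin i → Fin m) (ρ ρ' : Lit R ar (Fin m) → K), (∀ l, ρ l ≤ ρ' l ⊔ c) →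
      typeEval ε φ m e ρ ≤ typeEval ε φ m e ρ' ⊔ c := by
  induction φ with
  | eq | ne => intro m e ρ ρ' h; exact le_sup_left
  | atom r as pos => intro m e ρ ρ' h; exact h _
  | or φ θ ih₁ ih₂ =>
    intro m e ρ ρ' h
    simp only [typeEval]
    exact sup_le ((ih₁ m e ρ ρ' h).trans (sup_le_sup_right le_sup_left c))
      ((ih₂ m e ρ ρ' h).trans (sup_le_sup_right le_sup_right c))
  | and φ θ ih₁ ih₂ =>
    intro m e ρ ρ' h
    simp only [typeEval, sup_inf_right]
    exact inf_le_inf (ih₁ m e ρ ρ' h) (ih₂ m e ρ ρ' h)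
  | ex φ ih =>
    intro m e ρ ρ' h
    simp only [typeEval]
    refine sup_le (Finset.sup_le fun j hj => ?_) (Finset.sup_le fun s hs => ?_)
    · refine (ih m _ ρ ρ' h).trans (sup_le_sup_right (le_sup_of_le_left ?_) c)
      exact Finset.le_sup (f := fun j : Fin m => typeEval ε φ m (Fin.snoc e j) ρ') hj
    · refine (ih (m + 1) _ _ _ (extType_le_sup h le_sup_left s)).trans
        (sup_le_sup_right (le_sup_of_le_right ?_) c)
      exact Finset.le_sup (f := fun s : Atoms R ar (Fin (m + 1)) → Bool =>
        typeEval ε φ (m + 1) (Fin.snoc (fun j => (e j).castSucc) (Fin.last m))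
          (extType ρ' s ⊤)) hs
  | all φ ih =>
    intro m e ρ ρ' h
    simp only [typeEval, sup_inf_right, Finset.inf_sup_distrib_right]
    exact inf_le_inf (Finset.inf_mono_fun fun j _ => ih m _ ρ ρ' h)
      (Finset.inf_mono_fun fun s _ => ih (m + 1) _ _ _ (extType_le_sup h le_sup_left s))

theorem typeEval_mono (ε : K) {i : ℕ} (φ : FO R ar i) {m : ℕ} (e : Fin i → Fin m) :
    Monotone (typeEval ε φ m e) := fun ρ ρ' h => by
  simpa using typeEval_inf_le ε ⊤ φ m e ρ ρ' fun l => by simpa using h l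

theorem typeEval_extType_inf (ε : K) {i : ℕ} (φ : FO R ar i) {m : ℕ} (e : Fin i → Fin (m + 1))
    (ρ : Lit R ar (Fin m) → K) (s : Atoms R ar (Fin (m + 1)) → Bool) (t t' : K) :
    typeEval ε φ _ e (extType ρ s t) ⊓ typeEval ε φ _ e (extType ρ s t') ≤
      typeEval ε φ _ e (extType ρ s (t ⊓ t')) := by
  have h₁ := typeEval_inf_le ε t' φ _ e (extType ρ s t) (extType ρ s (t ⊓ t'))
    (extType_inf_le (fun _ => inf_le_left) le_rfl s)
  have h₂ := typeEval_le_sup ε t' φ _ e (extType ρ s t') (extType ρ s (t ⊓ t'))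
    (extType_le_sup (fun _ => le_sup_left) le_sup_right s)
  refine (inf_le_inf_left _ h₂).trans ?_
  rw [inf_sup_left]
  exact sup_le inf_le_right h₁

theorem inf_typeEval_extType_le (ε : K) {i : ℕ} (φ : FO R ar i) {m : ℕ}
    (e : Fin i → Fin (m + 1)) (ρ : Lit R ar (Fin m) → K)
    (s : Atoms R ar (Fin (m + 1)) → Bool) {S : Finset K} (hS : S.Nonempty) :
    (S.inf fun t => typeEval ε φ _ e (extType ρ s t)) ≤
      typeEval ε φ _ e (extType ρ s (S.inf id)) := by
  classical
  induction hS using Finset.Nonempty.cons_induction with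
  | singleton a => simp
  | cons a S ha hS ih =>
    simp only [Finset.inf_cons, id]
    exact (inf_le_inf_left _ ih).trans (typeEval_extType_inf ε φ e ρ s _ _)

theorem typeEval_mem (ε : K) {i : ℕ} (φ : FO R ar i) :
    ∀ (m : ℕ) (e : Fin i → Fin m) (ρ : Lit R ar (Fin m) → K),
      (∀ l, ρ l ∈ ({⊥, ⊤, ε} : Set K)) → typeEval ε φ m e ρ ∈ ({⊥, ⊤, ε} : Set K) := by
  have hsup : ∀ a ∈ ({⊥, ⊤, ε} : Set K), ∀ b ∈ ({⊥, ⊤, ε} : Set K),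
      a ⊔ b ∈ ({⊥, ⊤, ε} : Set K) := by
    rintro a (rfl | rfl | rfl) b (rfl | rfl | rfl) <;> simp
  have hinf : ∀ a ∈ ({⊥, ⊤, ε} : Set K), ∀ b ∈ ({⊥, ⊤, ε} : Set K),
      a ⊓ b ∈ ({⊥, ⊤, ε} : Set K) := by
    rintro a (rfl | rfl | rfl) b (rfl | rfl | rfl) <;> simp
  have hext : ∀ {m : ℕ} (ρ : Lit R ar (Fin m) → K) (s : Atoms R ar (Fin (m + 1)) → Bool) (t : K),
      (∀ l, ρ l ∈ ({⊥, ⊤, ε} : Set K)) → t ∈ ({⊥, ⊤, ε} : Set K) →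
      ∀ l, extType ρ s t l ∈ ({⊥, ⊤, ε} : Set K) := by
    intro m ρ s t h ht l
    unfold extType
    split_ifs
    · exact h _
    · exact ht
    · simp
  induction φ with
  | eq | ne => intro m e ρ h; simp only [typeEval]; split_ifs <;> simp
  | atom r as pos => intro m e ρ h; exact h _
  | or φ θ ih₁ ih₂ => intro m e ρ h; exact hsup _ (ih₁ m e ρ h) _ (ih₂ m e ρ h)
  | and φ θ ih₁ ih₂ => intro m e ρ h; exact hinf _ (ih₁ m e ρ h) _ (ih₂ m e ρ h)
  | ex φ ih =>
    intro m e ρ h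
    exact hsup _ (Finset.sup_mem _ (by simp) hsup _ _ fun j _ => ih m _ ρ h) _
      (Finset.sup_mem _ (by simp) hsup _ _ fun s _ =>
        ih (m + 1) _ _ (hext ρ s _ h (by simp)))
  | all φ ih =>
    intro m e ρ h
    exact hinf _ (Finset.inf_mem _ (by simp) hinf _ _ fun j _ => ih m _ ρ h) _
      (Finset.inf_mem _ (by simp) hinf _ _ fun s _ =>
        ih (m + 1) _ _ (hext ρ s _ h (by simp)))

end TypeEval

/-- Every injective tuple of fewer than `k` elements has, for every truth pattern `s` of the new
atoms and every `t ≠ ⊥`, an extension whose new true literals all have value `t`. -/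
def HasConstExtensions [Bot K] (π : Lit R ar A → K) (k : ℕ) : Prop :=
  ∀ m < k, ∀ a : Fin m → A, Function.Injective a →
    ∀ (s : Atoms R ar (Fin (m + 1)) → Bool) (t : K), t ≠ ⊥ →
      ∃ b ∉ Set.range a, typeOf π (Fin.snoc a b) = extType (typeOf π a) s t

/-- Quantifier rank of a formula. -/
def FO.rank : {i : ℕ} → FO R ar i → ℕ
  | _, .eq _ _ => 0
  | _, .ne _ _ => 0
  | _, .atom _ _ _ => 0
  | _, .or φ θ => max φ.rank θ.rank
  | _, .and φ θ => max φ.rank θ.rank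
  | _, .ex φ => φ.rank + 1
  | _, .all φ => φ.rank + 1

theorem comp_snoc_eq (a : A → B) {i : ℕ} (e : Fin i → A) (j : A) :
    (Fin.snoc (fun l => a (e l)) (a j) : Fin (i + 1) → B) =
      fun l => a ((Fin.snoc e j : Fin (i + 1) → A) l) := by
  funext l
  refine Fin.lastCases ?_ (fun l => ?_) l <;> simp

theorem snoc_comp_snoc_eq {m i : ℕ} (a : Fin m → A) (b : A) (e : Fin i → Fin m) :
    (Fin.snoc (fun l => a (e l)) b : Fin (i + 1) → A) = fun l =>
      (Fin.snoc a b : Fin (m + 1) → A)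
        ((Fin.snoc (fun j => (e j).castSucc) (Fin.last m) : Fin (i + 1) → Fin (m + 1)) l) := by
  funext l
  refine Fin.lastCases ?_ (fun l => ?_) l <;> simp

theorem snoc_injective {m : ℕ} {a : Fin m → A} (ha : Function.Injective a) {b : A}
    (hb : b ∉ Set.range a) : Function.Injective (Fin.snoc a b : Fin (m + 1) → A) :=
  Fin.snoc_injective_iff.2 ⟨ha, hb⟩

theorem typeOf_snoc_of_forall_ne_last {m : ℕ} (π : Lit R ar A → K) (a : Fin m → A) (b : A)
    (l : Lit R ar (Fin (m + 1))) (h : ∀ j, l.args j ≠ Fin.last m) :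
    typeOf π (Fin.snoc a b) l = typeOf π a ⟨l.rel, fun j => (l.args j).castPred (h j), l.pos⟩ := by
  unfold typeOf Lit.map
  congr 2
  funext j
  conv_lhs => rw [← Fin.castSucc_castPred (l.args j) (h j), Fin.snoc_castSucc]

/-- The truth pattern of the atoms of an interpretation on a tuple. -/
noncomputable def truthPattern [Bot K] [DecidableEq K] {m : ℕ} (π : Lit R ar A → K)
    (a : Fin m → A) : Atoms R ar (Fin m) → Bool :=
  fun α => decide (typeOf π a ⟨α.1, α.2, true⟩ ≠ ⊥)

theorem truthPattern_eq_iff [Bot K] [DecidableEq K] {m : ℕ} {π : Lit R ar A → K}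
    (hπ : ModelDefining ⊥ π) (a : Fin m → A) (l : Lit R ar (Fin m)) :
    truthPattern π a ⟨l.rel, l.args⟩ = l.pos ↔ typeOf π a l ≠ ⊥ := by
  obtain ⟨r, as, pos⟩ := l
  have h := hπ r fun j => a (as j)
  cases pos
  · simp only [truthPattern, decide_eq_false_iff_not, not_not]
    exact h
  · simp [truthPattern]

section Evaluation

variable [DistribLattice K] [BoundedOrder K] [DecidableEq K]

theorem typeOf_snoc_le_extType {π : Lit R ar A → K} (hπ : ModelDefining ⊥ π) {m : ℕ}
    (a : Fin m → A) (b : A) :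
    typeOf π (Fin.snoc a b) ≤ extType (typeOf π a) (truthPattern π (Fin.snoc a b)) ⊤ := by
  intro l
  unfold extType
  split_ifs with h h'
  · exact (typeOf_snoc_of_forall_ne_last π a b l h).le
  · exact le_top
  · rw [truthPattern_eq_iff hπ, not_not] at h'
    exact h'.le

variable [Fintype K]

theorem epsK_le {j : K} (hj : j ≠ ⊥) : epsK K ≤ j :=
  Finset.inf_le (f := id) (by simpa using hj)

theorem extType_le_typeOf_snoc {π : Lit R ar A → K} (hπ : ModelDefining ⊥ π) {m : ℕ}
    (a : Fin m → A) (b : A) :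
    extType (typeOf π a) (truthPattern π (Fin.snoc a b)) (epsK K) ≤ typeOf π (Fin.snoc a b) := by
  intro l
  unfold extType
  split_ifs with h h'
  · exact (typeOf_snoc_of_forall_ne_last π a b l h).ge
  · exact epsK_le ((truthPattern_eq_iff hπ _ _).1 h')
  · exact bot_le

variable [Nontrivial K] [Fintype R] [DecidableEq R] [Fintype A] [DecidableEq A]

theorem evalL_eq_typeEval {π : Lit R ar A → K} (hπ : ModelDefining ⊥ π) {k : ℕ}
    (hk : HasConstExtensions π k) {i : ℕ} (φ : FO R ar i) :
    ∀ (m : ℕ) (a : Fin m → A), Function.Injective a → m + φ.rank ≤ k → ∀ e : Fin i → Fin m,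
      evalL π φ (fun j => a (e j)) = typeEval (epsK K) φ m e (typeOf π a) := by
  induction φ with
  | eq | ne => intro m a ha _ e; simp [evalL, typeEval, ha.eq_iff]
  | atom r as pos => intro m a ha _ e; rfl
  | or φ θ ih₁ ih₂ | and φ θ ih₁ ih₂ =>
    intro m a ha hm e
    simp only [FO.rank] at hm
    simp only [evalL, typeEval]
    rw [ih₁ m a ha (by omega), ih₂ m a ha (by omega)]
  | ex φ ih =>
    intro m a ha hm e
    simp only [FO.rank] at hm
    simp only [evalL, typeEval]
    have hold : ∀ j, evalL π φ (Fin.snoc (fun l => a (e l)) (a j)) =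
        typeEval (epsK K) φ m (Fin.snoc e j) (typeOf π a) := fun j => by
      rw [comp_snoc_eq]; exact ih m a ha (by omega) _
    have hnew := fun (b : A) (hb : b ∉ Set.range a) =>
      (congrArg (evalL π φ) (snoc_comp_snoc_eq a b e)).trans
        (ih (m + 1) (Fin.snoc a b) (snoc_injective ha hb) (by omega) _)
    apply le_antisymm
    · refine Finset.sup_le fun b _ => ?_
      by_cases hb : b ∈ Set.range a
      · obtain ⟨j, rfl⟩ := hb
        rw [hold]
        exact le_sup_of_le_left (Finset.le_sup
          (f := fun j => typeEval (epsK K) φ m (Fin.snoc e j) (typeOf π a)) (Finset.mem_univ j))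
      · rw [hnew b hb]
        refine le_sup_of_le_right
          ((typeEval_mono _ φ _ (typeOf_snoc_le_extType hπ a b)).trans ?_)
        exact Finset.le_sup (f := fun s => typeEval (epsK K) φ (m + 1) _
          (extType (typeOf π a) s ⊤)) (Finset.mem_univ _)
    · refine sup_le (Finset.sup_le fun j _ => ?_) (Finset.sup_le fun s _ => ?_)
      · rw [← hold]
        exact Finset.le_sup (f := fun b => evalL π φ (Fin.snoc (fun l => a (e l)) b))
          (Finset.mem_univ _)
      · obtain ⟨b, hb, h⟩ := hk m (by omega) a ha s ⊤ top_ne_bot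
        rw [← h, ← hnew b hb]
        exact Finset.le_sup (f := fun b => evalL π φ (Fin.snoc (fun l => a (e l)) b))
          (Finset.mem_univ _)
  | all φ ih =>
    intro m a ha hm e
    simp only [FO.rank] at hm
    simp only [evalL, typeEval]
    have hold : ∀ j, evalL π φ (Fin.snoc (fun l => a (e l)) (a j)) =
        typeEval (epsK K) φ m (Fin.snoc e j) (typeOf π a) := fun j => by
      rw [comp_snoc_eq]; exact ih m a ha (by omega) _
    have hnew := fun (b : A) (hb : b ∉ Set.range a) =>
      (congrArg (evalL π φ) (snoc_comp_snoc_eq a b e)).trans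
        (ih (m + 1) (Fin.snoc a b) (snoc_injective ha hb) (by omega) _)
    apply le_antisymm
    · refine le_inf (Finset.le_inf fun j _ => ?_) (Finset.le_inf fun s _ => ?_)
      · rw [← hold]
        exact Finset.inf_le (f := fun b => evalL π φ (Fin.snoc (fun l => a (e l)) b))
          (Finset.mem_univ _)
      · refine le_trans (Finset.le_inf fun t ht => ?_) (inf_typeEval_extType_le _ φ _ _ s
          (S := Finset.univ.filter fun j : K => j ≠ ⊥) ⟨⊤, by simp⟩)
        obtain ⟨b, hb, h⟩ := hk m (by omega) a ha s t (by simpa using ht)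
        rw [← h, ← hnew b hb]
        exact Finset.inf_le (f := fun b => evalL π φ (Fin.snoc (fun l => a (e l)) b))
          (Finset.mem_univ _)
    · refine Finset.le_inf fun b _ => ?_
      by_cases hb : b ∈ Set.range a
      · obtain ⟨j, rfl⟩ := hb
        rw [hold]
        exact inf_le_of_left_le (Finset.inf_le
          (f := fun j => typeEval (epsK K) φ m (Fin.snoc e j) (typeOf π a)) (Finset.mem_univ j))
      · rw [hnew b hb]
        refine inf_le_of_right_le
          (le_trans ?_ (typeEval_mono _ φ _ (extType_le_typeOf_snoc hπ a b)))
        exact Finset.inf_le (f := fun s => typeEval (epsK K) φ (m + 1) _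
          (extType (typeOf π a) s (epsK K))) (Finset.mem_univ _)

end Evaluation

/-- A sequence is bounded by a null exponential sequence. -/
def ExpSmall (f : ℕ → ℝ≥0∞) : Prop :=
  ∃ C q : ℝ≥0∞, C ≠ ⊤ ∧ q < 1 ∧ ∀ n, f n ≤ C * q ^ n

theorem ExpSmall.add {f g : ℕ → ℝ≥0∞} (hf : ExpSmall f) (hg : ExpSmall g) :
    ExpSmall fun n => f n + g n := by
  obtain ⟨C, q, hC, hq, hf⟩ := hf
  obtain ⟨D, r, hD, hr, hg⟩ := hg
  refine ⟨C + D, max q r, ENNReal.add_ne_top.2 ⟨hC, hD⟩, max_lt hq hr, fun n => ?_⟩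
  rw [add_mul]
  refine add_le_add ((hf n).trans ?_) ((hg n).trans ?_)
  · gcongr; exact le_max_left _ _
  · gcongr; exact le_max_right _ _

theorem ExpSmall.zero : ExpSmall fun _ => 0 := ⟨0, 0, by simp, by simp, by simp⟩

theorem ExpSmall.sum {ι : Type*} (S : Finset ι) {f : ι → ℕ → ℝ≥0∞}
    (hf : ∀ i ∈ S, ExpSmall (f i)) : ExpSmall fun n => ∑ i ∈ S, f i n := by
  classical
  induction S using Finset.induction_on with
  | empty => simpa using ExpSmall.zero
  | insert i S hi ih =>
    simp only [Finset.sum_insert hi]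
    exact (hf i (by simp)).add (ih fun j hj => hf j (by simp [hj]))

theorem ExpSmall.mono {f g : ℕ → ℝ≥0∞} (hg : ExpSmall g) (h : ∀ n, f n ≤ g n) : ExpSmall f := by
  obtain ⟨C, q, hC, hq, hg⟩ := hg
  exact ⟨C, q, hC, hq, fun n => (h n).trans (hg n)⟩

theorem ExpSmall.expConv_zero {f : ℕ → ℝ≥0∞} (hf : ExpSmall f) : ExpConv f 0 := by
  obtain ⟨C, q, hC, hq, hf⟩ := hf
  exact ⟨C, q, hC, hq, fun n => ⟨by simpa using hf n, zero_le⟩⟩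

theorem ExpConv.tendsto {f : ℕ → ℝ≥0∞} {L : ℝ≥0∞} (hL : L ≠ ⊤) (hf : ExpConv f L) :
    Tendsto f atTop (nhds L) := by
  obtain ⟨C, q, hC, hq, hf⟩ := hf
  have h0 : Tendsto (fun n : ℕ => C * q ^ n) atTop (nhds 0) := by
    simpa using ENNReal.Tendsto.const_mul (ENNReal.tendsto_pow_atTop_nhds_zero_of_lt_one hq)
      (Or.inr hC)
  refine tendsto_of_tendsto_of_tendsto_of_le_of_le (g := fun n => L - C * q ^ n)
    (h := fun n => L + C * q ^ n) ?_ ?_ (fun n => tsub_le_iff_right.2 (hf n).2) fun n => (hf n).1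
  · simpa using ENNReal.Tendsto.sub tendsto_const_nhds h0 (Or.inl hL)
  · simpa using tendsto_const_nhds.add h0

theorem expSmall_pow_mul_pow_sub (m : ℕ) {r : ℝ≥0∞} (hr : r < 1) :
    ExpSmall fun n => (n : ℝ≥0∞) ^ m * r ^ (n - m) := by
  obtain ⟨x, hrx, hx1⟩ := exists_between hr
  have hx0 : x ≠ 0 := (zero_le.trans_lt hrx).ne'
  lift x to NNReal using hx1.ne_top
  have hx0' : 0 < x := pos_iff_ne_zero.2 (by exact_mod_cast hx0)
  have hx1' : (x : ℝ) < 1 := by exact_mod_cast hx1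
  set y : NNReal := NNReal.sqrt x with hy
  have hyy : y * y = x := NNReal.mul_self_sqrt x
  have hy1 : (y : ℝ) < 1 := by
    rw [hy, Real.coe_sqrt, Real.sqrt_lt' one_pos]; simpa using hx1'
  obtain ⟨B, hB⟩ := (tendsto_pow_const_mul_const_pow_of_lt_one m y.coe_nonneg hy1).bddAbove_range
  have hB : ∀ n : ℕ, (n : NNReal) ^ m * y ^ n ≤ B.toNNReal := fun n => by
    refine NNReal.le_toNNReal_of_coe_le ?_
    push_cast
    exact hB ⟨n, rfl⟩
  refine ⟨(B.toNNReal / x ^ m : NNReal), y, ENNReal.coe_ne_top, by exact_mod_cast hy1, fun n => ?_⟩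
  have h1 : x ^ (n - m) ≤ x ^ n / x ^ m := by
    rw [le_div_iff₀ (by positivity), ← pow_add]
    exact pow_le_pow_of_le_one zero_le (by exact_mod_cast hx1'.le) (by omega)
  calc (n : ℝ≥0∞) ^ m * r ^ (n - m) ≤ (n : ℝ≥0∞) ^ m * (x : ℝ≥0∞) ^ (n - m) := by gcongr
    _ = ((n ^ m * x ^ (n - m) : NNReal) : ℝ≥0∞) := by push_cast; rfl
    _ ≤ ((B.toNNReal / x ^ m * y ^ n : NNReal) : ℝ≥0∞) := by
      refine ENNReal.coe_le_coe.2 ?_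
      calc (n : NNReal) ^ m * x ^ (n - m) ≤ n ^ m * (x ^ n / x ^ m) := by gcongr
        _ = (n ^ m * y ^ n) / x ^ m * y ^ n := by rw [← hyy]; ring
        _ ≤ B.toNNReal / x ^ m * y ^ n := by gcongr; exact hB n
    _ = _ := by push_cast; rfl

section Independence

variable {ι X J : Type*} [Fintype ι] [MeasurableSpace X] (ν : Measure X)
  [IsProbabilityMeasure ν]

theorem pow_le_measure_pi_forall_eq {δ : ℝ≥0∞} (hδ : δ ≤ 1) {M : ℕ} {T : Finset ι}
    (hT : T.card ≤ M) {g : ι → X} (hg : ∀ c ∈ T, δ ≤ ν {g c}) :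
    δ ^ M ≤ Measure.pi (fun _ : ι => ν) {ω | ∀ c ∈ T, ω c = g c} := by
  classical
  have : {ω : ι → X | ∀ c ∈ T, ω c = g c} =
      Set.pi Set.univ fun c => if c ∈ T then {g c} else Set.univ := by
    ext ω
    simp only [mem_ofPred_eq, Set.mem_pi, Set.mem_univ, true_imp_iff]
    refine forall_congr' fun c => ?_
    split_ifs with h <;> simp [h]
  rw [this, Measure.pi_pi]
  calc δ ^ M ≤ δ ^ T.card := pow_le_pow_of_le_one zero_le hδ hT
    _ = ∏ c ∈ T, δ := by simp
    _ ≤ ∏ c ∈ T, ν {g c} := Finset.prod_le_prod' hg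
    _ = ∏ c : ι, if c ∈ T then ν {g c} else 1 := by simp [Finset.prod_ite_mem]
    _ = _ := Finset.prod_congr rfl fun c _ => by split_ifs <;> simp

theorem measure_pi_forall_exists_ne_le [MeasurableSingletonClass X] [Finite X] {δ : ℝ≥0∞}
    (hδ : δ ≤ 1) {M : ℕ} (S : Finset J)
    {T : J → Finset ι} (hdisj : (S : Set J).PairwiseDisjoint T)
    (hT : ∀ b, (T b).card ≤ M) {g : J → ι → X} (hg : ∀ b, ∀ c ∈ T b, δ ≤ ν {g b c}) :
    Measure.pi (fun _ : ι => ν) {ω | ∀ b ∈ S, ∃ c ∈ T b, ω c ≠ g b c} ≤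
      (1 - δ ^ M) ^ S.card := by
  classical
  induction S using Finset.induction_on with
  | empty => simp
  | insert b S hb ih =>
    have hindep : ProbabilityTheory.iIndepFun (fun c (ω : ι → X) => ω c)
        (Measure.pi fun _ : ι => ν) :=
      ProbabilityTheory.iIndepFun_pi (X := fun _ x => x) fun _ => aemeasurable_id
    have hST : Disjoint (T b) (S.biUnion T) := by
      rw [Finset.disjoint_biUnion_right]
      exact fun b' hb' => hdisj (by simp) (by simp [hb']) fun h => hb (h ▸ hb')
    have h := (hindep.indepFun_finset _ _ hST fun c => measurable_pi_apply c
      ).measure_inter_preimage_eq_mul {x | ∃ c : T b, x c ≠ g b c}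
        {x | ∀ b', ∀ hb' : b' ∈ S, ∃ c, ∃ hc : c ∈ T b',
          x ⟨c, Finset.mem_biUnion.2 ⟨b', hb', hc⟩⟩ ≠ g b' c}
        (Set.toFinite _).measurableSet (Set.toFinite _).measurableSet
    have heq : {ω : ι → X | ∀ b' ∈ insert b S, ∃ c ∈ T b', ω c ≠ g b' c} =
        (fun ω (c : T b) => ω c) ⁻¹' {x | ∃ c : T b, x c ≠ g b c} ∩
        (fun ω (c : S.biUnion T) => ω c) ⁻¹' {x | ∀ b', ∀ hb' : b' ∈ S, ∃ c, ∃ hc : c ∈ T b',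
          x ⟨c, Finset.mem_biUnion.2 ⟨b', hb', hc⟩⟩ ≠ g b' c} := by
      ext ω; simp
    have hc : (fun (ω : ι → X) (c : T b) => ω c) ⁻¹' {x | ∃ c : T b, x c ≠ g b c} =
        {ω | ∀ c ∈ T b, ω c = g b c}ᶜ := by
      ext ω; simp
    have hS : (fun (ω : ι → X) (c : S.biUnion T) => ω c) ⁻¹' {x | ∀ b', ∀ hb' : b' ∈ S,
        ∃ c, ∃ hc : c ∈ T b', x ⟨c, Finset.mem_biUnion.2 ⟨b', hb', hc⟩⟩ ≠ g b' c} =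
        {ω | ∀ b ∈ S, ∃ c ∈ T b, ω c ≠ g b c} := by
      ext ω; simp
    rw [heq, h, hS, hc, prob_compl_eq_one_sub (Set.toFinite _).measurableSet,
      Finset.card_insert_of_notMem hb, pow_succ']
    exact mul_le_mul' (tsub_le_tsub_left (pow_le_measure_pi_forall_eq ν hδ (hT b) (hg b)) 1)
      (ih (hdisj.subset (by simp)))

end Independence

/-- Renaming of an atom along a map of universes. -/
def atomMap (f : A → B) : Atoms R ar A → Atoms R ar B :=
  Sigma.map id fun _ as j => f (as j)

theorem atomMap_injective {f : A → B} (hf : Function.Injective f) :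
    Function.Injective (atomMap f : Atoms R ar A → Atoms R ar B) :=
  Function.injective_id.sigma_map fun _ => hf.comp_left

section AtomMeasure

variable [MeasurableSpace K] [MeasurableSingletonClass K] [Finite K] (z : K) (p : Measure K)

instance [IsProbabilityMeasure p] : IsProbabilityMeasure (atomMeasure z p) := by
  constructor
  have h₁ : Measurable fun j : K => (j, z) := measurable_of_finite _
  have h₂ : Measurable fun j : K => (z, j) := measurable_of_finite _
  simp only [atomMeasure, Measure.smul_apply, Measure.add_apply, Measure.map_apply h₁ .univ,
    Measure.map_apply h₂ .univ, Set.preimage_univ, measure_univ, smul_eq_mul, one_add_one_eq_two]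
  exact ENNReal.inv_mul_cancel (by simp) (by simp)

theorem half_mul_le_atomMeasure (t : K) :
    2⁻¹ * p {t} ≤ atomMeasure z p {(t, z)} ∧ 2⁻¹ * p {t} ≤ atomMeasure z p {(z, t)} := by
  have h₁ : Measurable fun j : K => (j, z) := measurable_of_finite _
  have h₂ : Measurable fun j : K => (z, j) := measurable_of_finite _
  simp only [atomMeasure, Measure.smul_apply, Measure.add_apply, smul_eq_mul,
    Measure.map_apply h₁ (measurableSet_singleton _),
    Measure.map_apply h₂ (measurableSet_singleton _)]
  constructor
  · refine mul_le_mul_right (le_add_right (measure_mono ?_)) _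
    rintro _ rfl; rfl
  · refine mul_le_mul_right (le_add_left (measure_mono ?_)) _
    rintro _ rfl; rfl

theorem ae_atomMeasure (hp : p {z} = 0) :
    ∀ᵐ x ∂atomMeasure z p, (x.1 = z ↔ x.2 ≠ z) := by
  have h₁ : Measurable fun j : K => (j, z) := measurable_of_finite _
  have h₂ : Measurable fun j : K => (z, j) := measurable_of_finite _
  rw [ae_iff]
  simp only [atomMeasure, Measure.smul_apply, Measure.add_apply, smul_eq_mul,
    Measure.map_apply h₁ (Set.toFinite _).measurableSet,
    Measure.map_apply h₂ (Set.toFinite _).measurableSet]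
  have e₁ : (fun j : K => (j, z)) ⁻¹' {x | ¬(x.1 = z ↔ x.2 ≠ z)} = {z} := by
    ext; simp
  have e₂ : (fun j : K => (z, j)) ⁻¹' {x | ¬(x.1 = z ↔ x.2 ≠ z)} = {z} := by
    ext; simp
  rw [e₁, e₂, hp]
  simp

variable [Fintype R] [IsProbabilityMeasure p]

instance (n : ℕ) : IsProbabilityMeasure (muI (ar := ar) z p n) := by
  unfold muI; infer_instance

theorem ae_modelDefining (hp : p {z} = 0) (n : ℕ) :
    ∀ᵐ ω ∂muI (ar := ar) z p n, ModelDefining z (interpOf ω) := by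
  have h : ∀ c : Atoms R ar (Fin n), ∀ᵐ ω ∂muI (ar := ar) z p n,
      ((ω c).1 = z ↔ (ω c).2 ≠ z) := fun c =>
    (Measure.tendsto_eval_ae_ae (μ := fun _ : Atoms R ar (Fin n) => atomMeasure z p) (i := c)
      ).eventually (ae_atomMeasure z p hp)
  filter_upwards [ae_all_iff.2 h] with ω hω r as
  exact hω ⟨r, as⟩

end AtomMeasure

/-- The atoms containing `b` whose other arguments lie in the range of `a`. -/
noncomputable def newAtoms [Fintype R] [Finite A] {m : ℕ} (a : Fin m → A) (b : A) :
    Finset (Atoms R ar A) := by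
  classical
  exact (Finset.univ.filter fun α : Atoms R ar (Fin (m + 1)) => ∃ j, α.2 j = Fin.last m).image
    (atomMap (Fin.snoc a b))

section NewAtoms

variable [Fintype R] [Finite A] {m : ℕ}

theorem atomMap_mem_newAtoms (a : Fin m → A) (b : A) {α : Atoms R ar (Fin (m + 1))}
    (hα : ∃ j, α.2 j = Fin.last m) : atomMap (Fin.snoc a b) α ∈ newAtoms a b := by
  classical
  exact Finset.mem_image_of_mem _ (by simpa using hα)

theorem card_newAtoms_le (a : Fin m → A) (b : A) :
    (newAtoms a b : Finset (Atoms R ar A)).card ≤ Fintype.card (Atoms R ar (Fin (m + 1))) := by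
  classical
  exact Finset.card_image_le.trans (Finset.card_le_univ _)

theorem disjoint_newAtoms {a : Fin m → A} {b b' : A} (hb : b ∉ Set.range a) (hbb' : b ≠ b') :
    Disjoint (newAtoms a b : Finset (Atoms R ar A)) (newAtoms a b') := by
  classical
  rw [Finset.disjoint_left]
  intro c hc hc'
  simp only [newAtoms, Finset.mem_image, Finset.mem_filter, Finset.mem_univ, true_and] at hc hc'
  have h : ∃ j, c.2 j = b := by
    obtain ⟨α, ⟨j, hj⟩, rfl⟩ := hc
    exact ⟨j, by simp [atomMap, Sigma.map, hj]⟩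
  have h' : ∀ j, c.2 j ∈ Set.range a ∨ c.2 j = b' := by
    obtain ⟨α, -, rfl⟩ := hc'
    intro j
    change (Fin.snoc a b' : Fin (m + 1) → A) (α.2 j) ∈ Set.range a ∨
      (Fin.snoc a b' : Fin (m + 1) → A) (α.2 j) = b'
    refine Fin.lastCases ?_ (fun i => ?_) (α.2 j) <;> simp
  obtain ⟨j, rfl⟩ := h
  exact (h' j).elim hb hbb'

end NewAtoms

/-- The values of the positive and the negative literal of each atom that make `extType` out of
the truth pattern `s` and the value `t`. -/
def patternValue [Bot K] (s : B → Bool) (t : K) (α : B) : K × K :=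
  if s α then (t, ⊥) else (⊥, t)

theorem typeOf_snoc_eq_extType [Bot K] {m : ℕ} (ω : Atoms R ar A → K × K) (a : Fin m → A) (b : A)
    (s : Atoms R ar (Fin (m + 1)) → Bool) (t : K)
    (h : ∀ α : Atoms R ar (Fin (m + 1)), (∃ j, α.2 j = Fin.last m) →
      ω (atomMap (Fin.snoc a b) α) = patternValue s t α) :
    typeOf (interpOf ω) (Fin.snoc a b) = extType (typeOf (interpOf ω) a) s t := by
  funext l
  unfold extType
  split_ifs with hl hs
  · exact typeOf_snoc_of_forall_ne_last _ a b l hl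
  all_goals
    push Not at hl
    have := h ⟨l.rel, l.args⟩ hl
    simp only [atomMap, Sigma.map, id, patternValue] at this
    obtain ⟨r, as, pos⟩ := l
    simp only at hs this
    simp only [typeOf, Lit.map, interpOf, this]
    cases pos <;> simp_all

section RandomInterpretation

variable [DistribLattice K] [BoundedOrder K] [Finite K] [MeasurableSpace K]
  [MeasurableSingletonClass K] [Fintype R] (p : Measure K) [IsProbabilityMeasure p]

theorem muI_not_exists_extension_le {m n : ℕ} (a : Fin m → Fin n)
    (s : Atoms R ar (Fin (m + 1)) → Bool) (t : K) :
    muI (ar := ar) ⊥ p n {ω | Function.Injective a ∧ ¬∃ b ∉ Set.range a,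
        typeOf (interpOf ω) (Fin.snoc a b) = extType (typeOf (interpOf ω) a) s t} ≤
      (1 - (2⁻¹ * p {t}) ^ Fintype.card (Atoms R ar (Fin (m + 1)))) ^ (n - m) := by
  classical
  by_cases ha : Function.Injective a
  swap
  · simp [ha]
  have hδ : 2⁻¹ * p {t} ≤ 1 := (half_mul_le_atomMeasure ⊥ p t).1.trans prob_le_one
  set S : Finset (Fin n) := Finset.univ \ Finset.univ.image a with hS
  have hcard : S.card = n - m := by
    rw [hS, Finset.card_sdiff_of_subset (Finset.subset_univ _),
      Finset.card_image_of_injective _ ha]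
    simp
  have hmem : ∀ b, b ∈ S ↔ b ∉ Set.range a := fun b => by simp [hS]
  set g : Fin n → Atoms R ar (Fin n) → K × K := fun b =>
    Function.extend (atomMap (Fin.snoc a b)) (patternValue s t) fun _ => (t, ⊥) with hg
  have hgt : ∀ b c, 2⁻¹ * p {t} ≤ atomMeasure ⊥ p {g b c} := by
    intro b c
    have h : g b c = (t, ⊥) ∨ g b c = (⊥, t) := by
      simp only [hg, Function.extend_def, patternValue]
      split_ifs <;> simp
    rcases h with h | h <;> rw [h]
    · exact (half_mul_le_atomMeasure ⊥ p t).1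
    · exact (half_mul_le_atomMeasure ⊥ p t).2
  rw [← hcard]
  refine (measure_mono ?_).trans (measure_pi_forall_exists_ne_le (atomMeasure ⊥ p) hδ S
    (T := fun b => newAtoms a b) (fun b hb b' _ hbb' => disjoint_newAtoms ((hmem b).1 hb) hbb')
    (fun b => card_newAtoms_le a b) (g := g) fun b c _ => hgt b c)
  rintro ω ⟨-, hω⟩ b hb
  rw [hmem] at hb
  by_contra! hcon
  refine hω ⟨b, hb, typeOf_snoc_eq_extType ω a b s t fun α hα => ?_⟩
  rw [hcon _ (atomMap_mem_newAtoms a b hα)]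
  exact (atomMap_injective (snoc_injective ha hb)).extend_apply _ _ _

theorem expSmall_muI_not_hasConstExtensions (hppos : ∀ j : K, j ≠ ⊥ → 0 < p {j}) (k : ℕ) :
    ExpSmall fun n => muI (ar := ar) ⊥ p n {ω | ¬HasConstExtensions (interpOf ω) k} := by
  classical
  have := Fintype.ofFinite K
  refine ExpSmall.mono (g := fun n => ∑ m ∈ Finset.range k,
    ∑ s : Atoms R ar (Fin (m + 1)) → Bool, ∑ t : {t : K // t ≠ ⊥}, (n : ℝ≥0∞) ^ m *
      (1 - (2⁻¹ * p {(t : K)}) ^ Fintype.card (Atoms R ar (Fin (m + 1)))) ^ (n - m)) ?_ ?_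
  · refine ExpSmall.sum _ fun m _ => ExpSmall.sum _ fun s _ => ExpSmall.sum _ fun t _ =>
      expSmall_pow_mul_pow_sub m (ENNReal.sub_lt_self (by simp) (by simp) (pow_ne_zero _ ?_))
    exact mul_ne_zero (by simp) (hppos t t.2).ne'
  · intro n
    have hsub : {ω : Atoms R ar (Fin n) → K × K | ¬HasConstExtensions (interpOf ω) k} ⊆
        ⋃ m ∈ Finset.range k, ⋃ s : Atoms R ar (Fin (m + 1)) → Bool, ⋃ t : {t : K // t ≠ ⊥},
          ⋃ a : Fin m → Fin n, {ω | Function.Injective a ∧ ¬∃ b ∉ Set.range a,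
            typeOf (interpOf ω) (Fin.snoc a b) = extType (typeOf (interpOf ω) a) s t} := by
      intro ω hω
      simp only [HasConstExtensions, mem_ofPred_eq, not_forall] at hω
      obtain ⟨m, hm, a, ha, s, t, ht, h⟩ := hω
      simp only [mem_iUnion, Finset.mem_range]
      exact ⟨m, hm, s, ⟨t, ht⟩, a, ha, h⟩
    refine (measure_mono hsub).trans ((measure_biUnion_finset_le _ _).trans ?_)
    refine Finset.sum_le_sum fun m _ => (measure_iUnion_fintype_le _ _).trans ?_
    refine Finset.sum_le_sum fun s _ => (measure_iUnion_fintype_le _ _).trans ?_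
    refine Finset.sum_le_sum fun t _ => (measure_iUnion_fintype_le _ _).trans ?_
    refine (Finset.sum_le_sum fun a _ => muI_not_exists_extension_le p a s t).trans ?_
    simp

end RandomInterpretation

section ZeroOneLaw

variable [DistribLattice K] [BoundedOrder K] [Nontrivial K] [Fintype K] [DecidableEq K]
  [MeasurableSpace K] [MeasurableSingletonClass K] [Fintype R] [DecidableEq R]
  {p : Measure K} [IsProbabilityMeasure p]

theorem expSmall_muI_evalL_ne_typeEval (har : ∀ r, 0 < ar r) (hp0 : p {(⊥ : K)} = 0)
    (hppos : ∀ j : K, j ≠ ⊥ → 0 < p {j}) (ψ : FO R ar 0) :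
    ExpSmall fun n => muI (ar := ar) (⊥ : K) p n {ω | evalL (interpOf ω) ψ Fin.elim0 ≠
      typeEval (epsK K) ψ 0 Fin.elim0 fun _ => ⊥} := by
  refine (expSmall_muI_not_hasConstExtensions p hppos ψ.rank).mono fun n => measure_mono_ae ?_
  filter_upwards [ae_modelDefining (ar := ar) ⊥ p hp0 n] with ω hω hne hk
  refine hne ?_
  have h := evalL_eq_typeEval hω hk ψ 0 Fin.elim0 (fun i => i.elim0) (by simp) Fin.elim0
  have : IsEmpty (Lit R ar (Fin 0)) := ⟨fun l => (l.args ⟨0, har _⟩).elim0⟩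
  rw [Subsingleton.elim (fun _ : Lit R ar (Fin 0) => (⊥ : K)) _]
  convert h

theorem expConv_one_of_expSmall_compl {Ω : ℕ → Type*} [∀ n, MeasurableSpace (Ω n)]
    (P : ∀ n, Measure (Ω n)) [∀ n, IsProbabilityMeasure (P n)] {E : ∀ n, Set (Ω n)}
    (h : ExpSmall fun n => P n (E n)ᶜ) : ExpConv (fun n => P n (E n)) 1 := by
  obtain ⟨C, q, hC, hq, h⟩ := h
  refine ⟨C, q, hC, hq, fun n => ⟨prob_le_one.trans le_self_add, ?_⟩⟩
  calc (1 : ℝ≥0∞) = P n (E n ∪ (E n)ᶜ) := by simp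
    _ ≤ P n (E n) + P n (E n)ᶜ := measure_union_le _ _
    _ ≤ P n (E n) + C * q ^ n := by gcongr; exact h n

end ZeroOneLaw

/-- (0-1 law for FO on finite lattice semirings.) Let `K` be a
finite lattice semiring with a probability distribution `p` on `K⁺` that is positive
on every nonzero element.  Then for every sentence `ψ` and every `j ∈ K`, the
probability `μ_{n,p}[π⟦ψ⟧ = j]` converges exponentially fast to `0` or `1`, and the
set of almost sure valuations of sentences is exactly `{0, 1, ε_K}`. -/
theorem statement_2
    {R : Type} [Fintype R] [DecidableEq R] [Nonempty R]
    {ar : R → ℕ} (har : ∀ r, 0 < ar r)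
    {K : Type} [DistribLattice K] [BoundedOrder K] [Nontrivial K]
    [Fintype K] [DecidableEq K]
    [MeasurableSpace K] [MeasurableSingletonClass K]
    (p : Measure K) [IsProbabilityMeasure p]
    (hp0 : p {(⊥ : K)} = 0) (hppos : ∀ j : K, j ≠ ⊥ → 0 < p {j}) :
    (∀ (ψ : FO R ar 0) (j : K),
      ExpConv (fun n =>
        muI (ar := ar) (⊥ : K) p n
          {ω | evalL (interpOf ω) ψ Fin.elim0 = j}) 0 ∨
      ExpConv (fun n =>
        muI (ar := ar) (⊥ : K) p n
          {ω | evalL (interpOf ω) ψ Fin.elim0 = j}) 1) ∧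
    {j : K | ∃ ψ : FO R ar 0,
        Tendsto (fun n =>
          muI (ar := ar) (⊥ : K) p n
            {ω | evalL (interpOf ω) ψ Fin.elim0 = j}) atTop (nhds 1)}
      = {⊥, ⊤, epsK K} := by
  have hone : ∀ ψ : FO R ar 0, ExpConv (fun n => muI (ar := ar) (⊥ : K) p n
      {ω | evalL (interpOf ω) ψ Fin.elim0 = typeEval (epsK K) ψ 0 Fin.elim0 fun _ => ⊥}) 1 :=
    fun ψ => expConv_one_of_expSmall_compl (fun n => muI (ar := ar) (⊥ : K) p n)
      (expSmall_muI_evalL_ne_typeEval har hp0 hppos ψ)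
  have hzero : ∀ (ψ : FO R ar 0) (j : K), j ≠ typeEval (epsK K) ψ 0 Fin.elim0 (fun _ => ⊥) →
      ExpConv (fun n => muI (ar := ar) (⊥ : K) p n
        {ω | evalL (interpOf ω) ψ Fin.elim0 = j}) 0 := fun ψ j hj =>
    ((expSmall_muI_evalL_ne_typeEval har hp0 hppos ψ).mono fun n => measure_mono fun ω hω => by
      simp only [mem_ofPred_eq] at hω ⊢; rwa [hω]).expConv_zero
  refine ⟨fun ψ j => ?_, ?_⟩
  · by_cases hj : j = typeEval (epsK K) ψ 0 Fin.elim0 fun _ => ⊥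
    · exact Or.inr (hj ▸ hone ψ)
    · exact Or.inl (hzero ψ j hj)
  · have hval : ∀ (ψ : FO R ar 0) (v : K), typeEval (epsK K) ψ 0 Fin.elim0 (fun _ => ⊥) = v →
        ∃ ψ : FO R ar 0, Tendsto (fun n => muI (ar := ar) (⊥ : K) p n
          {ω | evalL (interpOf ω) ψ Fin.elim0 = v}) atTop (nhds 1) := fun ψ v h =>
      ⟨ψ, h ▸ (hone ψ).tendsto ENNReal.one_ne_top⟩
    ext j
    constructor
    · rintro ⟨ψ, hψ⟩
      by_cases hj : j = typeEval (epsK K) ψ 0 Fin.elim0 fun _ => ⊥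
      · exact hj ▸ typeEval_mem _ ψ _ _ _ (by simp)
      · have := tendsto_nhds_unique hψ ((hzero ψ j hj).tendsto ENNReal.zero_ne_top)
        simp at this
    · obtain ⟨r⟩ := ‹Nonempty R›
      rintro (rfl | rfl | rfl)
      · exact hval (.ex (.ne 0 0)) _ (by simp [typeEval])
      · exact hval (.all (.eq 0 0)) _ (by simp [typeEval])
      · refine hval (.all (.or (.atom r (fun _ => 0) true) (.atom r (fun _ => 0) false))) _ ?_
        have : Nonempty (Fin (ar r)) := ⟨⟨0, har r⟩⟩
        have hs : ∀ s : Atoms R ar (Fin (0 + 1)) → Bool,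
            extType (fun _ => ⊥) s (epsK K) ⟨r, fun _ => 0, true⟩ ⊔
              extType (fun _ => ⊥) s (epsK K) ⟨r, fun _ => 0, false⟩ = epsK K := by
          intro s
          cases h : s ⟨r, fun _ => 0⟩ <;> simp_all [extType]
        simpa [typeEval, Fin.snoc, hs] using
          Finset.inf_const (Finset.univ_nonempty (α := Atoms R ar (Fin (0 + 1)) → Bool)) (epsK K)
end

section
/- Let p: ℕ∖{0} → [0,1] be a probability distribution with p[x≥2] > 0 and τ a finite relational vocabulary. Then for every k ∈ ℕ there exists γ > 0 such that the probability under μ_{n,p} that a random ℕ-interpretation on [n] has the strong (k,γ)-extension property converges to 1 as n → ∞ (exponentially fast). -/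
open MeasureTheory Filter Set
open scoped ENNReal BigOperators

variable {R : Type} {ar : R → ℕ} {A B K : Type}

/-- The extension `ρp` (of an atomic type, to the variables `x_1,…,x_{m+1}`) is *large*:
out of each pair of complementary literals containing the new variable, one is mapped
to `0` and the other to a number `≥ 2`. -/
def LargeExt {m : ℕ} (ρp : Lit R ar (Fin (m+1)) → ℕ) : Prop :=
  ∀ (r : R) (as : Fin (ar r) → Fin (m+1)), (∃ j, as j = Fin.last m) →
    ((ρp ⟨r, as, true⟩ = 0 ∧ 2 ≤ ρp ⟨r, as, false⟩) ∨
     (2 ≤ ρp ⟨r, as, true⟩ ∧ ρp ⟨r, as, false⟩ = 0))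

/-- `ρ =_𝔹 ρ'`: the two atomic types map exactly the same literals to `0`. -/
def BoolEq {m : ℕ} (ρ ρ' : Lit R ar (Fin m) → ℕ) : Prop := ∀ l, (ρ l = 0 ↔ ρ' l = 0)

/-- The strong `(k,γ)`-extension property of an `ℕ`-interpretation: for every tuple and
every extension of its type, at least `γ·|A|` elements realise a large extension with
the same underlying Boolean type. -/
def StrongExtProp (π : Lit R ar A → ℕ) (k : ℕ) (γ : ℝ) : Prop :=
  ∀ m, m < k → ∀ a : Fin m → A, Function.Injective a →
    ∀ ρp : Lit R ar (Fin (m+1)) → ℕ, ModelDefining 0 ρp → Extends ρp (typeOf π a) →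
      γ * (Nat.card A) ≤
        ({b : A | b ∉ Set.range a ∧ BoolEq (typeOf π (Fin.snoc a b)) ρp ∧
          LargeExt (typeOf π (Fin.snoc a b))}.ncard : ℝ)

open ProbabilityTheory Asymptotics

/-- Boxes over pairwise disjoint blocks of coordinates of an independent family are independent. -/
theorem iIndepSet_block_of_iIndepFun {Ω α ι ν E : Type*} [Fintype ν] [MeasurableSpace Ω]
    [MeasurableSpace E] {μ : Measure Ω} {f : α → Ω → E} (hf : iIndepFun f μ)
    (hfm : ∀ i, Measurable (f i)) {Φ : ι × ν → α} (hΦ : Function.Injective Φ)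
    {G : ν → Set E} (hG : ∀ x, MeasurableSet (G x)) :
    iIndepSet (fun b => {ω | ∀ x, f (Φ (b, x)) ω ∈ G x}) μ := by
  have hblock : ∀ T : Finset ι, μ (⋂ b ∈ T, {ω | ∀ x, f (Φ (b, x)) ω ∈ G x}) =
      ∏ b ∈ T, ∏ x, μ (f (Φ (b, x)) ⁻¹' G x) := by
    intro T
    have h := (hf.precomp hΦ).measure_inter_preimage_eq_mul (T ×ˢ Finset.univ)
      (sets := fun i => G i.2) (fun i _ => hG i.2)
    rw [Finset.prod_product] at h
    rw [← h]
    congr 1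
    ext ω
    simp only [Set.mem_iInter, Finset.mem_product, Finset.mem_univ, and_true, Prod.forall]
    exact ⟨fun h b x hb => h b hb x, fun h b hb x => h b x hb⟩
  rw [iIndepSet_iff_meas_biInter]
  · intro T
    rw [hblock T]
    refine Finset.prod_congr rfl fun b _ => ?_
    simpa using (hblock {b}).symm
  · intro b
    rw [Set.ofPred_forall]
    exact MeasurableSet.iInter fun x => hfm _ (hG x)

/-- Hoeffding's inequality for the number of independent events that occur. -/
theorem measureReal_ncard_lt_le_exp {Ω ι : Type*} [Fintype ι] [MeasurableSpace Ω]
    {μ : Measure Ω} [IsProbabilityMeasure μ] {S : ι → Set Ω} (hS : iIndepSet S μ)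
    (hm : ∀ b, MeasurableSet (S b)) {δ : ℝ} (hδ : 0 ≤ δ) (hle : ∀ b, δ ≤ μ.real (S b)) :
    μ.real {ω | ({b | ω ∈ S b}.ncard : ℝ) < δ / 2 * Fintype.card ι} ≤
      Real.exp (-(Fintype.card ι * δ ^ 2 / 2)) := by
  classical
  set X : ι → Ω → ℝ := fun b => (S b).indicator fun _ => 1
  have hX : iIndepFun X μ := hS.iIndepFun_indicator
  have hXm : ∀ b, Measurable (X b) := fun b => measurable_const.indicator (hm b)
  have hmem : ∀ b ω, -X b ω ∈ Set.Icc (-1 : ℝ) 0 := by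
    intro b ω
    by_cases h : ω ∈ S b <;> simp [X, h]
  have hint : ∀ b, ∫ ω, -X b ω ∂μ = -μ.real (S b) := by
    intro b
    rw [integral_neg, integral_indicator_const _ (hm b)]
    simp
  have hY : iIndepFun (fun b ω => -X b ω - ∫ ω, -X b ω ∂μ) μ :=
    hX.comp (fun b x => -x - ∫ ω, -X b ω ∂μ) fun b => by fun_prop
  have hoeff := HasSubgaussianMGF.measure_sum_ge_le_of_iIndepFun hY (s := Finset.univ)
    (fun b _ => hasSubgaussianMGF_of_mem_Icc (hXm b).neg.aemeasurable
      (Eventually.of_forall (hmem b))) (ε := Fintype.card ι * (δ / 2)) (by positivity)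
  have hcount : ∀ ω, ({b | ω ∈ S b}.ncard : ℝ) = ∑ b, X b ω := by
    intro ω
    rw [Set.ncard_eq_toFinset_card']
    simp [X, Set.indicator_apply, Finset.sum_boole]
  refine (measureReal_mono ?_).trans (hoeff.trans_eq ?_)
  · intro ω hω
    rw [Set.mem_ofPred_eq, hcount] at hω
    simp only [Set.mem_ofPred_eq, hint, Finset.sum_sub_distrib, Finset.sum_neg_distrib]
    have : (Fintype.card ι : ℝ) * δ ≤ ∑ b, μ.real (S b) := by
      simpa using Finset.card_nsmul_le_sum Finset.univ (fun b => μ.real (S b)) δ fun b _ => hle b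
    linarith
  · congr 1
    rcases Nat.eq_zero_or_pos (Fintype.card ι) with h0 | h0
    · simp [h0]
    · have : (0 : ℝ) < Fintype.card ι := by exact_mod_cast h0
      simp
      field_simp

theorem expConv_one_of_isBigO {f : ℕ → ℝ≥0∞} {g : ℕ → ℝ} {q : ℝ} (hq0 : 0 < q) (hq1 : q < 1)
    (hle : ∀ n, f n ≤ 1) (hge : ∀ᶠ n in atTop, 1 ≤ (f n).toReal + g n)
    (hg : g =O[atTop] fun n => q ^ n) : ExpConv f 1 := by
  have hle' : ∀ n, (f n).toReal ≤ 1 := fun n => ENNReal.toReal_le_of_le_ofReal one_pos.le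
    (by simpa using hle n)
  have hfg : (fun n => 1 - (f n).toReal) =O[atTop] g := by
    refine IsBigO.of_bound' ?_
    filter_upwards [hge] with n hn
    rw [Real.norm_of_nonneg (sub_nonneg.2 (hle' n))]
    exact (sub_le_iff_le_add'.2 hn).trans (le_abs_self _)
  obtain ⟨C, hC, hbound⟩ := bound_of_isBigO_nat_atTop (hfg.trans hg)
  refine ⟨ENNReal.ofReal C, ENNReal.ofReal q, ENNReal.ofReal_ne_top, by simpa using hq1,
    fun n => ⟨(hle n).trans le_self_add, ?_⟩⟩
  have hn := hbound (x := n) (pow_pos hq0 n).ne'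
  rw [Real.norm_of_nonneg (pow_pos hq0 n).le, Real.norm_of_nonneg (sub_nonneg.2 (hle' n))] at hn
  rw [← ENNReal.ofReal_pow hq0.le, ← ENNReal.ofReal_mul hC.le,
    ← ENNReal.ofReal_toReal ((hle n).trans_lt ENNReal.one_lt_top).ne,
    ← ENNReal.ofReal_add ENNReal.toReal_nonneg (by positivity)]
  exact ENNReal.one_le_ofReal.2 (by linarith)

/-- The pairs of values that make an atom true (resp. false) with a value at least `2`. -/
def largeValues (s : Bool) : Set (ℕ × ℕ) :=
  if s then {v | 2 ≤ v.1 ∧ v.2 = 0} else {v | v.1 = 0 ∧ 2 ≤ v.2}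

theorem atomMeasure_largeValues (p : Measure ℕ) (s : Bool) :
    atomMeasure 0 p (largeValues s) = 2⁻¹ * p {j | 2 ≤ j} := by
  have hm : ∀ g : ℕ → ℕ × ℕ, Measure.map g p (largeValues s) = p (g ⁻¹' largeValues s) :=
    fun g => Measure.map_apply (measurable_of_countable g) (Set.to_countable _).measurableSet
  rw [atomMeasure, Measure.smul_apply, Measure.add_apply, hm, hm]
  cases s <;> simp [largeValues]

instance isProbabilityMeasure_atomMeasure (p : Measure ℕ) [IsProbabilityMeasure p] :
    IsProbabilityMeasure (atomMeasure 0 p) := by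
  constructor
  simp [atomMeasure, Measure.map_apply (measurable_of_countable _), ENNReal.inv_two_add_inv_two]

instance isProbabilityMeasure_muI [Fintype R] (p : Measure ℕ) [IsProbabilityMeasure p] (n : ℕ) :
    IsProbabilityMeasure (muI (ar := ar) 0 p n) := by
  unfold muI
  infer_instance

/-- The atoms over the variables `x_1,…,x_{m+1}` in which `x_{m+1}` occurs. -/
abbrev NewAtoms (R : Type) (ar : R → ℕ) (m : ℕ) : Type :=
  {x : Atoms R ar (Fin (m + 1)) // ∃ j, x.2 j = Fin.last m}

/-- The instantiation of an atom with the tuple `a` followed by the element `b`. -/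
def instAtom {m : ℕ} (a : Fin m → A) (i : {b : A // b ∉ Set.range a} × NewAtoms R ar m) :
    Atoms R ar A :=
  ⟨i.2.1.1, fun j => (Fin.snoc a i.1.1 : Fin (m + 1) → A) (i.2.1.2 j)⟩

theorem instAtom_injective {m : ℕ} {a : Fin m → A} (ha : Function.Injective a) :
    Function.Injective (instAtom (R := R) (ar := ar) a) := by
  rintro ⟨⟨b, hb⟩, ⟨r, f⟩, j, hj⟩ ⟨⟨b', hb'⟩, ⟨r', f'⟩, h'⟩ h
  simp only [instAtom, Sigma.mk.injEq] at h
  obtain ⟨rfl, h⟩ := h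
  have h := congrFun (eq_of_heq h)
  have hbb : b = b' := by
    have hj' := h j
    simp only at hj
    rw [hj, Fin.snoc_last] at hj'
    induction hx : f' j using Fin.lastCases with
    | last => rwa [hx, Fin.snoc_last] at hj'
    | cast i =>
      rw [hx, Fin.snoc_castSucc] at hj'
      exact absurd ⟨i, hj'.symm⟩ hb
  subst hbb
  have hff : f = f' := funext fun j => Fin.snoc_injective_iff.2 ⟨ha, hb⟩ (h j)
  subst hff
  rfl

/-- The elements whose addition to the tuple `a` makes every new atom true or false as
prescribed by `σ`, with value at least `2`. -/
def largeRealizers {m : ℕ} (ω : Atoms R ar A → ℕ × ℕ) (a : Fin m → A)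
    (σ : NewAtoms R ar m → Bool) : Set {b : A // b ∉ Set.range a} :=
  {b | ∀ x, ω (instAtom a (b, x)) ∈ largeValues (σ x)}

theorem boolEq_and_largeExt_of_mem_largeRealizers {m : ℕ} {ω : Atoms R ar A → ℕ × ℕ}
    {a : Fin m → A} {ρp : Lit R ar (Fin (m + 1)) → ℕ} (hρ : ModelDefining 0 ρp)
    (hext : Extends ρp (typeOf (interpOf ω) a)) {b : {b : A // b ∉ Set.range a}}
    (hb : b ∈ largeRealizers ω a fun x => decide (ρp ⟨x.1.1, x.1.2, true⟩ ≠ 0)) :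
    BoolEq (typeOf (interpOf ω) (Fin.snoc a b.1)) ρp ∧
      LargeExt (typeOf (interpOf ω) (Fin.snoc a b.1)) := by
  have hnew : ∀ (r : R) (as : Fin (ar r) → Fin (m + 1)), (∃ j, as j = Fin.last m) →
      ω ⟨r, fun j => (Fin.snoc a b.1 : Fin (m + 1) → A) (as j)⟩ ∈
        largeValues (decide (ρp ⟨r, as, true⟩ ≠ 0)) :=
    fun r as h => hb ⟨⟨r, as⟩, h⟩
  refine ⟨?_, fun r as h => ?_⟩
  · rintro ⟨r, as, s⟩
    by_cases h : ∃ j, as j = Fin.last m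
    · have hv := hnew r as h
      have hρv := hρ r as
      by_cases h0 : ρp ⟨r, as, true⟩ = 0
      · cases s <;> simp_all [largeValues, typeOf, interpOf, Lit.map]; omega
      · cases s <;> simp_all [largeValues, typeOf, interpOf, Lit.map]; omega
    · push Not at h
      choose as' has using fun j => Fin.exists_castSucc_eq.2 (h j)
      obtain rfl : (fun j => (as' j).castSucc) = as := funext has
      have := hext ⟨r, as', s⟩
      simp only [Lit.map] at this
      rw [this]
      simp [typeOf, Lit.map]
  · have hv := hnew r as h
    by_cases h0 : ρp ⟨r, as, true⟩ = 0 <;>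
      simp_all [largeValues, typeOf, interpOf, Lit.map]

theorem strongExtProp_of_forall_largeRealizers [Finite A] {ω : Atoms R ar A → ℕ × ℕ} {k : ℕ}
    {γ : ℝ} (h : ∀ m < k, ∀ a : Fin m → A, Function.Injective a → ∀ σ,
      γ * Nat.card A ≤ (largeRealizers ω a σ).ncard) :
    StrongExtProp (interpOf ω) k γ := by
  intro m hm a ha ρp hρ hext
  refine (h m hm a ha fun x => decide (ρp ⟨x.1.1, x.1.2, true⟩ ≠ 0)).trans ?_
  rw [← Set.ncard_image_of_injective _ Subtype.val_injective]
  refine Nat.cast_le.2 (Set.ncard_le_ncard ?_ (Set.toFinite _))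
  rintro _ ⟨b, hb, rfl⟩
  exact ⟨b.2, boolEq_and_largeExt_of_mem_largeRealizers hρ hext hb⟩

theorem muI_mem_largeRealizers [Fintype R] (p : Measure ℕ) [IsProbabilityMeasure p] {n m : ℕ}
    {a : Fin m → Fin n} (ha : Function.Injective a) (σ : NewAtoms R ar m → Bool)
    (b : {b // b ∉ Set.range a}) :
    (muI 0 p n).real {ω | b ∈ largeRealizers ω a σ} =
      (2⁻¹ * p.real {j | 2 ≤ j}) ^ Nat.card (NewAtoms R ar m) := by
  classical
  have hinj : Function.Injective fun x : NewAtoms R ar m => instAtom a (b, x) :=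
    fun x y h => (Prod.ext_iff.1 (instAtom_injective ha h)).2
  have hind : iIndepFun (fun x ω => ω x) (muI (ar := ar) 0 p n) :=
    iIndepFun_pi (X := fun _ v => v) fun _ => aemeasurable_id
  have h := (hind.precomp hinj).measure_inter_preimage_eq_mul Finset.univ
    (sets := fun x => largeValues (σ x)) fun _ _ => (Set.to_countable _).measurableSet
  have hset : {ω | b ∈ largeRealizers ω a σ} = ⋂ x ∈ (Finset.univ : Finset (NewAtoms R ar m)),
      (fun ω : Atoms R ar (Fin n) → ℕ × ℕ => ω (instAtom a (b, x))) ⁻¹' largeValues (σ x) := by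
    ext ω
    simp [largeRealizers]
  have heval : ∀ x : NewAtoms R ar m, muI 0 p n
      ((fun ω : Atoms R ar (Fin n) → ℕ × ℕ => ω (instAtom a (b, x))) ⁻¹' largeValues (σ x)) =
        2⁻¹ * p {j | 2 ≤ j} := fun x => by
    rw [← atomMeasure_largeValues p (σ x)]
    exact (measurePreserving_eval _ _).measure_preimage
      (Set.to_countable _).measurableSet.nullMeasurableSet
  rw [measureReal_def, hset, h, Finset.prod_congr rfl fun x _ => heval x]
  simp [measureReal_def, Nat.card_eq_fintype_card]

theorem muI_ncard_largeRealizers_lt_le [Fintype R] (p : Measure ℕ) [IsProbabilityMeasure p]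
    {n m : ℕ} {a : Fin m → Fin n} (ha : Function.Injective a) (σ : NewAtoms R ar m → Bool)
    {δ : ℝ} (hδ0 : 0 ≤ δ)
    (hδ : δ ≤ (2⁻¹ * p.real {j | 2 ≤ j}) ^ Nat.card (NewAtoms R ar m)) :
    (muI 0 p n).real {ω | ((largeRealizers ω a σ).ncard : ℝ) < δ / 2 * (n - m)} ≤
      Real.exp (-((n - m) * δ ^ 2 / 2)) := by
  classical
  have hcard : (Fintype.card {b // b ∉ Set.range a} : ℝ) = n - m := by
    have hmn : m ≤ n := by simpa using Fintype.card_le_of_injective a ha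
    have hrange : Fintype.card {b // b ∈ Set.range a} = m :=
      (Set.card_range_of_injective ha).trans (Fintype.card_fin m)
    rw [Fintype.card_subtype_compl, ← Nat.cast_sub hmn, Fintype.card_fin, hrange]
  have hind : iIndepFun (fun x ω => ω x) (muI (ar := ar) 0 p n) :=
    iIndepFun_pi (X := fun _ v => v) fun _ => aemeasurable_id
  have hS : iIndepSet (fun b => {ω | b ∈ largeRealizers ω a σ}) (muI (ar := ar) 0 p n) :=
    iIndepSet_block_of_iIndepFun hind (fun x => measurable_pi_apply x) (instAtom_injective ha)
      fun x => (Set.to_countable (largeValues (σ x))).measurableSet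
  have h := measureReal_ncard_lt_le_exp hS (fun _ => (Set.to_countable _).measurableSet) hδ0
    fun b => hδ.trans_eq (muI_mem_largeRealizers p ha σ b).symm
  rwa [hcard] at h

theorem isBigO_pow_mul_exp_pow {δ : ℝ} (hδ : 0 < δ) (m : ℕ) (M : ℝ) :
    (fun n : ℕ => (n : ℝ) ^ m * M * Real.exp (-((n - m) * δ ^ 2 / 2))) =O[atTop]
      fun n => Real.exp (-(δ ^ 2 / 4)) ^ n := by
  have hlt : ‖Real.exp (-(δ ^ 2 / 2))‖ < Real.exp (-(δ ^ 2 / 4)) := by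
    rw [Real.norm_of_nonneg (Real.exp_pos _).le, Real.exp_lt_exp]
    nlinarith [pow_pos hδ 2]
  refine ((isLittleO_pow_const_mul_const_pow_const_pow_of_norm_lt m hlt).isBigO.const_mul_left
    (M * Real.exp (m * δ ^ 2 / 2))).congr_left fun n => ?_
  rw [← Real.exp_nat_mul, mul_mul_mul_comm, mul_assoc _ _ (Real.exp (-((n - m) * δ ^ 2 / 2))),
    show -((n - m) * δ ^ 2 / 2) = m * δ ^ 2 / 2 + n * -(δ ^ 2 / 2) by ring, Real.exp_add]
  ring

theorem muI_strongExtProp_ge [Fintype R] (p : Measure ℕ) [IsProbabilityMeasure p] {k n : ℕ}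
    (hn : 2 * k ≤ n) {δ : ℝ} (hδ0 : 0 ≤ δ)
    (hδ : ∀ m < k, δ ≤ (2⁻¹ * p.real {j | 2 ≤ j}) ^ Nat.card (NewAtoms R ar m)) :
    1 ≤ (muI (ar := ar) 0 p n).real {ω | StrongExtProp (interpOf ω) k (δ / 4)} +
      ∑ m : Fin k, (n : ℝ) ^ (m : ℕ) * Nat.card (NewAtoms R ar m → Bool) *
        Real.exp (-((n - m) * δ ^ 2 / 2)) := by
  classical
  set bad : (m : Fin k) → (Fin m ↪ Fin n) → (NewAtoms R ar m → Bool) →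
    Set (Atoms R ar (Fin n) → ℕ × ℕ) :=
      fun m a σ => {ω | ((largeRealizers ω a σ).ncard : ℝ) < δ / 2 * (n - m)}
  have hcover : Set.univ ⊆ {ω | StrongExtProp (interpOf ω) k (δ / 4)} ∪
      ⋃ m, ⋃ a, ⋃ σ, bad m a σ := by
    intro ω _
    rw [Set.mem_union, or_iff_not_imp_right]
    intro h
    simp only [Set.mem_iUnion, not_exists] at h
    refine strongExtProp_of_forall_largeRealizers fun m hm a ha σ => ?_
    refine le_trans ?_ (not_lt.1 (h ⟨m, hm⟩ ⟨a, ha⟩ σ))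
    have hmn : (2 * m : ℝ) ≤ n := by exact_mod_cast (by omega : 2 * m ≤ n)
    rw [Nat.card_eq_fintype_card, Fintype.card_fin]
    nlinarith
  have hbad : ∀ m : Fin k, (muI 0 p n).real (⋃ a, ⋃ σ, bad m a σ) ≤
      (n : ℝ) ^ (m : ℕ) * Nat.card (NewAtoms R ar m → Bool) *
        Real.exp (-((n - m) * δ ^ 2 / 2)) := by
    intro m
    have hcard : (Fintype.card (Fin m ↪ Fin n) : ℝ) ≤ (n : ℝ) ^ (m : ℕ) := by
      rw [Fintype.card_embedding_eq, Fintype.card_fin, Fintype.card_fin]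
      exact_mod_cast Nat.descFactorial_le_pow n m
    calc (muI 0 p n).real (⋃ a, ⋃ σ, bad m a σ)
        ≤ ∑ a, ∑ σ, (muI 0 p n).real (bad m a σ) :=
          (measureReal_iUnion_fintype_le _).trans
            (Finset.sum_le_sum fun a _ => measureReal_iUnion_fintype_le _)
      _ ≤ ∑ _a : Fin m ↪ Fin n, ∑ _σ : NewAtoms R ar m → Bool,
            Real.exp (-((n - m) * δ ^ 2 / 2)) :=
          Finset.sum_le_sum fun a _ => Finset.sum_le_sum fun σ _ =>
            muI_ncard_largeRealizers_lt_le p a.injective σ hδ0 (hδ m m.2)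
      _ = Fintype.card (Fin m ↪ Fin n) * Nat.card (NewAtoms R ar m → Bool) *
            Real.exp (-((n - m) * δ ^ 2 / 2)) := by
          rw [Nat.card_eq_fintype_card, mul_assoc]
          simp only [Finset.sum_const, Finset.card_univ, nsmul_eq_mul]
      _ ≤ _ := by gcongr
  calc (1 : ℝ) = (muI (ar := ar) 0 p n).real Set.univ := probReal_univ.symm
    _ ≤ _ := measureReal_mono hcover
    _ ≤ _ := measureReal_union_le _ _
    _ ≤ _ := by
      gcongr
      exact (measureReal_iUnion_fintype_le _).trans (Finset.sum_le_sum fun m _ => hbad m)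

/-- Let `p` be a probability distribution on `ℕ ∖ {0}` with
`p[x ≥ 2] > 0`.  Then for every `k` there exists `γ > 0` such that random
`ℕ`-interpretations on `[n]` have the strong `(k,γ)`-extension property with
probability converging to 1 (exponentially fast). -/
theorem statement_12
    {R : Type} [Fintype R] [DecidableEq R] {ar : R → ℕ}
    (p : Measure ℕ) [IsProbabilityMeasure p]
    (hp0 : p {0} = 0) (hp2 : 0 < p {j : ℕ | 2 ≤ j})
    (k : ℕ) :
    ∃ γ : ℝ, 0 < γ ∧
      ExpConv (fun n =>
        muI (ar := ar) (0 : ℕ) p n {ω | StrongExtProp (interpOf ω) k γ}) 1 := by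
  set c : ℝ := 2⁻¹ * p.real {j | 2 ≤ j}
  have hc0 : 0 < c := mul_pos (by norm_num) (ENNReal.toReal_pos hp2.ne' (measure_ne_top _ _))
  have hc1 : c ≤ 1 := by
    have : p.real {j | 2 ≤ j} ≤ 1 := measureReal_le_one
    simp only [c]
    linarith
  set δ : ℝ := c ^ ∑ m ∈ Finset.range k, Nat.card (NewAtoms R ar m)
  have hδ0 : 0 < δ := pow_pos hc0 _
  have hδ : ∀ m < k, δ ≤ c ^ Nat.card (NewAtoms R ar m) := fun m hm =>
    pow_le_pow_of_le_one hc0.le hc1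
      (Finset.single_le_sum (f := fun m => Nat.card (NewAtoms R ar m)) (fun _ _ => Nat.zero_le _)
        (Finset.mem_range.2 hm))
  refine ⟨δ / 4, by positivity, expConv_one_of_isBigO (Real.exp_pos (-(δ ^ 2 / 4))) ?_
    (fun n => prob_le_one) ?_ (IsBigO.fun_sum (s := Finset.univ) fun (m : Fin k) _ =>
      isBigO_pow_mul_exp_pow hδ0 m (Nat.card (NewAtoms R ar m → Bool)))⟩
  · rw [Real.exp_lt_one_iff]
    have := pow_pos hδ0 2
    linarith
  · filter_upwards [eventually_ge_atTop (2 * k)] with n hn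
    exact muI_strongExtProp_ge p hn hδ0.le hδ
end
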